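/- (Proposition) For the N-trader system-plus-reservoir hamiltonian H, the total number operator N̂ = n̂ + Σ_{q∈Λ} N̂_q, the total cash operator K̂ = k̂ + Σ_{q∈Λ} K̂_q, and the operator Γ̂ = P̂ + Σ_{q∈Λ} Ô_q are constants of motion: [H, N̂] = [H, K̂] = [H, Γ̂] = 0, where [A,B] = AB − BA. -/

import Mathlib

/- Context: the N-trader system-plus-reservoir stock market. Λ is a finite set
labelling the reservoir traders. V is the free complex vector space on basis
vectors indexed by tuples (n; k; m; (N_q); (K_q); (O_q)). -/

noncomputable section

/-- The basis index: shares n, cash k, price m of the system trader τ, and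
shares N_q, cash K_q, supply O_q for each reservoir trader q ∈ Λ. -/
structure IdxR (Λ : Type*) where
  n : ℕ
  k : ℕ
  m : ℕ
  Ns : Λ → ℕ
  Ks : Λ → ℕ
  Os : Λ → ℕ

variable (Λ : Type*) [Fintype Λ] [DecidableEq Λ]

abbrev VR := IdxR Λ →₀ ℂ

/-- Generic bosonic annihilation operator on the coordinate described by `get`/`set`. -/
def ann (get : IdxR Λ → ℕ) (set : IdxR Λ → ℕ → IdxR Λ) : Module.End ℂ (VR Λ) :=
  Finsupp.lift _ ℂ (IdxR Λ) fun i =>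
    Finsupp.single (set i (get i - 1)) ((Real.sqrt (get i) : ℝ) : ℂ)

/-- Generic bosonic creation operator on the coordinate described by `get`/`set`. -/
def cre (get : IdxR Λ → ℕ) (set : IdxR Λ → ℕ → IdxR Λ) : Module.End ℂ (VR Λ) :=
  Finsupp.lift _ ℂ (IdxR Λ) fun i =>
    Finsupp.single (set i (get i + 1)) ((Real.sqrt (get i + 1) : ℝ) : ℂ)

/-- Generic operator C^P̂ of cash lowering by the price index m:
φ ↦ φ if m = 0; 0 if m > k; √(k(k−1)⋯(k−m+1))·(φ with k ↦ k−m) if 0 < m ≤ k. -/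
def lowerPow (getk : IdxR Λ → ℕ) (setk : IdxR Λ → ℕ → IdxR Λ) : Module.End ℂ (VR Λ) :=
  Finsupp.lift _ ℂ (IdxR Λ) fun i =>
    if i.m ≤ getk i then
      Finsupp.single (setk i (getk i - i.m))
        ((Real.sqrt (∏ j ∈ Finset.range i.m, ((getk i : ℝ) - j)) : ℝ) : ℂ)
    else 0

/-- Generic operator (C†)^P̂ of cash raising by the price index m:
φ ↦ φ if m = 0; √((k+1)⋯(k+m))·(φ with k ↦ k+m) if m > 0. -/
def raisePow (getk : IdxR Λ → ℕ) (setk : IdxR Λ → ℕ → IdxR Λ) : Module.End ℂ (VR Λ) :=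
  Finsupp.lift _ ℂ (IdxR Λ) fun i =>
    Finsupp.single (setk i (getk i + i.m))
      ((Real.sqrt (∏ j ∈ Finset.range i.m, ((getk i : ℝ) + j + 1)) : ℝ) : ℂ)

def aOp : Module.End ℂ (VR Λ) := ann Λ (·.n) (fun i v => { i with n := v })
def adag : Module.End ℂ (VR Λ) := cre Λ (·.n) (fun i v => { i with n := v })
def cOp : Module.End ℂ (VR Λ) := ann Λ (·.k) (fun i v => { i with k := v })
def cdag : Module.End ℂ (VR Λ) := cre Λ (·.k) (fun i v => { i with k := v })
def pOp : Module.End ℂ (VR Λ) := ann Λ (·.m) (fun i v => { i with m := v })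
def pdag : Module.End ℂ (VR Λ) := cre Λ (·.m) (fun i v => { i with m := v })
def AOp (q : Λ) : Module.End ℂ (VR Λ) :=
  ann Λ (fun i => i.Ns q) (fun i v => { i with Ns := Function.update i.Ns q v })
def Adag (q : Λ) : Module.End ℂ (VR Λ) :=
  cre Λ (fun i => i.Ns q) (fun i v => { i with Ns := Function.update i.Ns q v })
def COp (q : Λ) : Module.End ℂ (VR Λ) :=
  ann Λ (fun i => i.Ks q) (fun i v => { i with Ks := Function.update i.Ks q v })
def Cdag (q : Λ) : Module.End ℂ (VR Λ) :=
  cre Λ (fun i => i.Ks q) (fun i v => { i with Ks := Function.update i.Ks q v })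
def oOp (q : Λ) : Module.End ℂ (VR Λ) :=
  ann Λ (fun i => i.Os q) (fun i v => { i with Os := Function.update i.Os q v })
def odag (q : Λ) : Module.End ℂ (VR Λ) :=
  cre Λ (fun i => i.Os q) (fun i v => { i with Os := Function.update i.Os q v })

def nhat : Module.End ℂ (VR Λ) := adag Λ * aOp Λ
def khat : Module.End ℂ (VR Λ) := cdag Λ * cOp Λ
def Phat : Module.End ℂ (VR Λ) := pdag Λ * pOp Λ
def Nhat (q : Λ) : Module.End ℂ (VR Λ) := Adag Λ q * AOp Λ q
def Khat (q : Λ) : Module.End ℂ (VR Λ) := Cdag Λ q * COp Λ q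
def Ohat (q : Λ) : Module.End ℂ (VR Λ) := odag Λ q * oOp Λ q

/-- c^P̂ for the system trader. -/
def cPowP : Module.End ℂ (VR Λ) := lowerPow Λ (·.k) (fun i v => { i with k := v })
/-- (c†)^P̂ for the system trader. -/
def cdagPowP : Module.End ℂ (VR Λ) := raisePow Λ (·.k) (fun i v => { i with k := v })
/-- C_q^P̂ for a reservoir trader q. -/
def CPowP (q : Λ) : Module.End ℂ (VR Λ) :=
  lowerPow Λ (fun i => i.Ks q) (fun i v => { i with Ks := Function.update i.Ks q v })
/-- (C_q†)^P̂ for a reservoir trader q. -/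
def CdagPowP (q : Λ) : Module.End ℂ (VR Λ) :=
  raisePow Λ (fun i => i.Ks q) (fun i v => { i with Ks := Function.update i.Ks q v })

/-- z = a·(c†)^P̂. -/
def zOp : Module.End ℂ (VR Λ) := aOp Λ * cdagPowP Λ
/-- z† = a†·c^P̂. -/
def zdag : Module.End ℂ (VR Λ) := adag Λ * cPowP Λ
/-- Z_q = A_q·(C_q†)^P̂. -/
def ZOp (q : Λ) : Module.End ℂ (VR Λ) := AOp Λ q * CdagPowP Λ q
/-- Z_q† = A_q†·C_q^P̂. -/
def Zdag (q : Λ) : Module.End ℂ (VR Λ) := Adag Λ q * CPowP Λ q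

/-- The smeared field Z(f) = Σ_q f(q) Z_q. -/
def Zf (f : Λ → ℂ) : Module.End ℂ (VR Λ) := ∑ q, f q • ZOp Λ q
/-- The smeared field Z†(f̄) = Σ_q conj(f(q)) Z_q†. -/
def Zdagf (f : Λ → ℂ) : Module.End ℂ (VR Λ) := ∑ q, (starRingEnd ℂ) (f q) • Zdag Λ q
/-- The smeared field o(g) = Σ_q g(q) o_q. -/
def og (g : Λ → ℂ) : Module.End ℂ (VR Λ) := ∑ q, g q • oOp Λ q
/-- The smeared field o†(ḡ) = Σ_q conj(g(q)) o_q†. -/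
def odagg (g : Λ → ℂ) : Module.End ℂ (VR Λ) := ∑ q, (starRingEnd ℂ) (g q) • odag Λ q

/-- The system-plus-reservoir hamiltonian
H = ω_a n̂ + ω_c k̂ + ω_p P̂ + Σ_q( Ω_A(q)N̂_q + Ω_C(q)K̂_q + Ω_O(q)Ô_q )
  + λ[ ( z†Z(f) + z Z†(f̄) ) + ( p†o(g) + p o†(ḡ) ) ]. -/
def HamR (ωa ωc ωp lam : ℝ) (ΩA ΩC ΩO : Λ → ℝ) (f g : Λ → ℂ) : Module.End ℂ (VR Λ) :=
  (ωa : ℂ) • nhat Λ + (ωc : ℂ) • khat Λ + (ωp : ℂ) • Phat Λ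
    + (∑ q, (((ΩA q : ℝ) : ℂ) • Nhat Λ q + ((ΩC q : ℝ) : ℂ) • Khat Λ q
        + ((ΩO q : ℝ) : ℂ) • Ohat Λ q))
    + (lam : ℂ) • ((zdag Λ * Zf Λ f + zOp Λ * Zdagf Λ f)
        + (pdag Λ * og Λ g + pOp Λ * odagg Λ g))

/-- The commutator [A,B] = AB − BA. -/
def opComm (A B : Module.End ℂ (VR Λ)) : Module.End ℂ (VR Λ) := A * B - B * A

set_option linter.unusedSectionVars false

variable {Λ}

/-- Every basis vector `φ_j` occurring in the image of `φ_i` under `T` satisfies `R i j`. -/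
def Moves (T : Module.End ℂ (VR Λ)) (R : IdxR Λ → IdxR Λ → Prop) : Prop :=
  ∀ i j, T (Finsupp.single i 1) j ≠ 0 → R i j

/-- `T` is diagonal in the basis, with eigenvalue `w i` at `φ_i`. -/
def DiagonalWith (T : Module.End ℂ (VR Λ)) (w : IdxR Λ → ℕ) : Prop :=
  ∀ i, T (Finsupp.single i 1) = (w i : ℂ) • Finsupp.single i 1

/-- The total number of shares. -/
def totalShares (i : IdxR Λ) : ℕ := i.n + ∑ q, i.Ns q

/-- The total cash. -/
def totalCash (i : IdxR Λ) : ℕ := i.k + ∑ q, i.Ks q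

/-- The price plus the total supply. -/
def totalSupply (i : IdxR Λ) : ℕ := i.m + ∑ q, i.Os q

/-- The two indices have the same total shares, cash and supply. -/
def SameTotals (i j : IdxR Λ) : Prop :=
  totalShares j = totalShares i ∧ totalCash j = totalCash i ∧ totalSupply j = totalSupply i

/-- One share is sold at the current price: shares decrease by one and cash increases by `m`. -/
def SellsShare (i j : IdxR Λ) : Prop :=
  j.m = i.m ∧ totalShares j + 1 = totalShares i ∧ totalCash j = totalCash i + i.m ∧
    totalSupply j = totalSupply i

/-- The supply decreases by one. -/
def LowersSupply (i j : IdxR Λ) : Prop :=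
  totalShares j = totalShares i ∧ totalCash j = totalCash i ∧ totalSupply j + 1 = totalSupply i

namespace Moves

variable {S T : Module.End ℂ (VR Λ)} {R R' : IdxR Λ → IdxR Λ → Prop}

theorem mono (h : Moves T R) (hR : ∀ i j, R i j → R' i j) : Moves T R' :=
  fun i j hij => hR i j (h i j hij)

theorem add (hS : Moves S R) (hT : Moves T R) : Moves (S + T) R := by
  intro i j hij
  by_contra hR
  exact hij (by simp [not_imp_comm.1 (hS i j) hR, not_imp_comm.1 (hT i j) hR])

theorem smul (c : ℂ) (hT : Moves T R) : Moves (c • T) R := by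
  intro i j hij
  by_contra hR
  exact hij (by simp [not_imp_comm.1 (hT i j) hR])

theorem sum {F : Λ → Module.End ℂ (VR Λ)} (h : ∀ q, Moves (F q) R) :
    Moves (∑ q, F q) R := by
  intro i j hij
  by_contra hR
  refine hij ?_
  rw [LinearMap.sum_apply, Finsupp.finsetSum_apply]
  exact Finset.sum_eq_zero fun q _ => not_imp_comm.1 (h q i j) hR

theorem mul (hS : Moves S R') (hT : Moves T R) : Moves (S * T) (Relation.Comp R R') := by
  intro i j hij
  rw [Module.End.mul_apply, ← Finsupp.sum_single (T (Finsupp.single i 1)), Finsupp.sum, map_sum,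
    Finsupp.finsetSum_apply] at hij
  obtain ⟨l, -, hl⟩ := Finset.exists_ne_zero_of_sum_ne_zero hij
  rw [← mul_one (T (Finsupp.single i 1) l), ← smul_eq_mul, ← Finsupp.smul_single, map_smul,
    Finsupp.smul_apply] at hl
  exact ⟨l, hT i l (left_ne_zero_of_smul hl), hS l j (right_ne_zero_of_smul hl)⟩

end Moves

namespace DiagonalWith

variable {S T : Module.End ℂ (VR Λ)} {v w : IdxR Λ → ℕ}

theorem add (hS : DiagonalWith S v) (hT : DiagonalWith T w) :
    DiagonalWith (S + T) (fun i => v i + w i) := by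
  intro i
  rw [LinearMap.add_apply, hS, hT, Nat.cast_add, add_smul]

theorem sum {F : Λ → Module.End ℂ (VR Λ)} {u : Λ → IdxR Λ → ℕ}
    (h : ∀ q, DiagonalWith (F q) (u q)) :
    DiagonalWith (∑ q, F q) (fun i => ∑ q, u q i) := by
  intro i
  rw [LinearMap.sum_apply, Nat.cast_sum, Finset.sum_smul]
  exact Finset.sum_congr rfl fun q _ => h q i

theorem apply_apply (h : DiagonalWith T w) (x : VR Λ) (j : IdxR Λ) : T x j = w j * x j := by
  induction x using Finsupp.induction_linear with
  | zero => simp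
  | add x y hx hy => simp [hx, hy, mul_add]
  | single i c =>
    rw [← mul_one c, ← smul_eq_mul, ← Finsupp.smul_single, map_smul, h]
    by_cases hij : i = j
    · subst hij
      simp [mul_comm]
    · simp [hij]

theorem moves_sameTotals (h : DiagonalWith T w) : Moves T SameTotals := by
  intro i j hij
  rw [h.apply_apply] at hij
  obtain rfl : i = j := (Finsupp.single_apply_ne_zero.1 (right_ne_zero_of_mul hij)).1.symm
  exact ⟨rfl, rfl, rfl⟩

theorem opComm_eq_zero (h : DiagonalWith T w) (hS : Moves S fun i j => w j = w i) :
    opComm Λ S T = 0 := by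
  refine Finsupp.lhom_ext' fun i => LinearMap.ext_ring (Finsupp.ext fun j => ?_)
  simp only [opComm, LinearMap.comp_apply, Finsupp.lsingle_apply, LinearMap.sub_apply,
    Module.End.mul_apply, Finsupp.sub_apply, h.apply_apply, h i, map_smul, Finsupp.smul_apply,
    smul_eq_mul, LinearMap.zero_apply, Finsupp.coe_zero, Pi.zero_apply]
  by_cases hij : S (Finsupp.single i 1) j = 0
  · simp [hij]
  · rw [hS i j hij, sub_self]

end DiagonalWith

section Ladder

variable (get : IdxR Λ → ℕ) (set : IdxR Λ → ℕ → IdxR Λ)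

theorem ann_single (i : IdxR Λ) : ann Λ get set (Finsupp.single i 1) =
    Finsupp.single (set i (get i - 1)) ((Real.sqrt (get i) : ℝ) : ℂ) := by
  simp only [ann, Finsupp.lift_apply, zero_smul, Finsupp.sum_single_index, one_smul]

theorem cre_single (i : IdxR Λ) : cre Λ get set (Finsupp.single i 1) =
    Finsupp.single (set i (get i + 1)) ((Real.sqrt (get i + 1) : ℝ) : ℂ) := by
  simp only [cre, Finsupp.lift_apply, zero_smul, Finsupp.sum_single_index, one_smul]

theorem moves_ann : Moves (ann Λ get set) fun i j => 0 < get i ∧ j = set i (get i - 1) := by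
  intro i j hij
  rw [ann_single, Finsupp.single_apply_ne_zero] at hij
  refine ⟨Nat.pos_of_ne_zero fun h => hij.2 ?_, hij.1⟩
  simp [h]

theorem moves_cre : Moves (cre Λ get set) fun i j => j = set i (get i + 1) := by
  intro i j hij
  rw [cre_single, Finsupp.single_apply_ne_zero] at hij
  exact hij.1

theorem moves_lowerPow :
    Moves (lowerPow Λ get set) fun i j => i.m ≤ get i ∧ j = set i (get i - i.m) := by
  intro i j hij
  by_cases h : i.m ≤ get i
  · simp only [lowerPow, Finsupp.lift_apply, zero_smul, Finsupp.sum_single_index, one_smul, h,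
      if_true, Finsupp.single_apply_ne_zero] at hij
    exact ⟨h, hij.1⟩
  · simp [lowerPow, h] at hij

theorem moves_raisePow : Moves (raisePow Λ get set) fun i j => j = set i (get i + i.m) := by
  intro i j hij
  simp only [raisePow, Finsupp.lift_apply, zero_smul, Finsupp.sum_single_index, one_smul,
    Finsupp.single_apply_ne_zero] at hij
  exact hij.1

variable {get set}

theorem diagonalWith_cre_mul_ann (get_set : ∀ i v, get (set i v) = v)
    (set_set : ∀ i v v', set (set i v) v' = set i v') (set_get : ∀ i, set i (get i) = i) :
    DiagonalWith (cre Λ get set * ann Λ get set) get := by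
  intro i
  rw [Module.End.mul_apply, ann_single]
  rcases Nat.eq_zero_or_pos (get i) with h | h
  · simp [h]
  · rw [← mul_one ((Real.sqrt (get i) : ℝ) : ℂ), ← smul_eq_mul, ← Finsupp.smul_single, map_smul,
      cre_single, get_set, set_set, Nat.sub_add_cancel h, set_get, Nat.cast_sub h, Nat.cast_one,
      sub_add_cancel, Finsupp.smul_single, Finsupp.smul_single, smul_eq_mul, smul_eq_mul, mul_one,
      ← Complex.ofReal_mul, Real.mul_self_sqrt (Nat.cast_nonneg _), Complex.ofReal_natCast]

end Ladder

theorem sum_update_add (x : Λ → ℕ) (q : Λ) (v : ℕ) :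
    (∑ r, Function.update x q v r) + x q = (∑ r, x r) + v := by
  rw [Finset.sum_update_of_mem (Finset.mem_univ q), ← Finset.add_sum_erase _ x (Finset.mem_univ q),
    Finset.sdiff_singleton_eq_erase]
  ring

theorem diagonalWith_nhat : DiagonalWith (nhat Λ) (·.n) :=
  diagonalWith_cre_mul_ann (fun _ _ => rfl) (fun _ _ _ => rfl) fun _ => rfl

theorem diagonalWith_khat : DiagonalWith (khat Λ) (·.k) :=
  diagonalWith_cre_mul_ann (fun _ _ => rfl) (fun _ _ _ => rfl) fun _ => rfl

theorem diagonalWith_Phat : DiagonalWith (Phat Λ) (·.m) :=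
  diagonalWith_cre_mul_ann (fun _ _ => rfl) (fun _ _ _ => rfl) fun _ => rfl

theorem diagonalWith_Nhat (q : Λ) : DiagonalWith (Nhat Λ q) (·.Ns q) :=
  diagonalWith_cre_mul_ann (by simp) (by simp) (by simp)

theorem diagonalWith_Khat (q : Λ) : DiagonalWith (Khat Λ q) (·.Ks q) :=
  diagonalWith_cre_mul_ann (by simp) (by simp) (by simp)

theorem diagonalWith_Ohat (q : Λ) : DiagonalWith (Ohat Λ q) (·.Os q) :=
  diagonalWith_cre_mul_ann (by simp) (by simp) (by simp)

theorem moves_zOp : Moves (zOp Λ) SellsShare := by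
  refine ((moves_ann _ _).mul (moves_raisePow _ _)).mono ?_
  rintro i j ⟨_, rfl, h, rfl⟩
  simp only [SellsShare, totalShares, totalCash, totalSupply] at h ⊢
  lia

theorem moves_zdag : Moves (zdag Λ) (flip SellsShare) := by
  refine ((moves_cre _ _).mul (moves_lowerPow _ _)).mono ?_
  rintro i j ⟨_, ⟨h, rfl⟩, rfl⟩
  simp only [flip, SellsShare, totalShares, totalCash, totalSupply] at h ⊢
  lia

theorem moves_ZOp (q : Λ) : Moves (ZOp Λ q) SellsShare := by
  refine ((moves_ann _ _).mul (moves_raisePow _ _)).mono ?_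
  rintro i j ⟨_, rfl, h, rfl⟩
  have hN := sum_update_add i.Ns q (i.Ns q - 1)
  have hK := sum_update_add i.Ks q (i.Ks q + i.m)
  simp only [SellsShare, totalShares, totalCash, totalSupply] at h ⊢
  lia

theorem moves_Zdag (q : Λ) : Moves (Zdag Λ q) (flip SellsShare) := by
  refine ((moves_cre _ _).mul (moves_lowerPow _ _)).mono ?_
  rintro i j ⟨_, ⟨h, rfl⟩, rfl⟩
  have hN := sum_update_add i.Ns q (i.Ns q + 1)
  have hK := sum_update_add i.Ks q (i.Ks q - i.m)
  simp only [flip, SellsShare, totalShares, totalCash, totalSupply] at h ⊢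
  lia

theorem moves_pOp : Moves (pOp Λ) LowersSupply := by
  refine (moves_ann _ _).mono ?_
  rintro i j ⟨h, rfl⟩
  simp only [LowersSupply, totalShares, totalCash, totalSupply] at h ⊢
  lia

theorem moves_pdag : Moves (pdag Λ) (flip LowersSupply) := by
  refine (moves_cre _ _).mono ?_
  rintro i j rfl
  simp only [flip, LowersSupply, totalShares, totalCash, totalSupply]
  lia

theorem moves_oOp (q : Λ) : Moves (oOp Λ q) LowersSupply := by
  refine (moves_ann _ _).mono ?_
  rintro i j ⟨h, rfl⟩
  have hO := sum_update_add i.Os q (i.Os q - 1)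
  simp only [LowersSupply, totalShares, totalCash, totalSupply] at h ⊢
  lia

theorem moves_odag (q : Λ) : Moves (odag Λ q) (flip LowersSupply) := by
  refine (moves_cre _ _).mono ?_
  rintro i j rfl
  have hO := sum_update_add i.Os q (i.Os q + 1)
  simp only [flip, LowersSupply, totalShares, totalCash, totalSupply]
  lia

theorem sameTotals_of_sell_buy (i j : IdxR Λ)
    (h : Relation.Comp SellsShare (flip SellsShare) i j) : SameTotals i j := by
  obtain ⟨l, h, h'⟩ := h
  simp only [flip, SellsShare, SameTotals] at *
  lia

theorem sameTotals_of_buy_sell (i j : IdxR Λ)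
    (h : Relation.Comp (flip SellsShare) SellsShare i j) : SameTotals i j := by
  obtain ⟨l, h, h'⟩ := h
  simp only [flip, SellsShare, SameTotals] at *
  lia

theorem sameTotals_of_lower_raise (i j : IdxR Λ)
    (h : Relation.Comp LowersSupply (flip LowersSupply) i j) : SameTotals i j := by
  obtain ⟨l, h, h'⟩ := h
  simp only [flip, LowersSupply, SameTotals] at *
  lia

theorem sameTotals_of_raise_lower (i j : IdxR Λ)
    (h : Relation.Comp (flip LowersSupply) LowersSupply i j) : SameTotals i j := by
  obtain ⟨l, h, h'⟩ := h
  simp only [flip, LowersSupply, SameTotals] at *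
  lia

theorem moves_HamR (ωa ωc ωp lam : ℝ) (ΩA ΩC ΩO : Λ → ℝ) (f g : Λ → ℂ) :
    Moves (HamR Λ ωa ωc ωp lam ΩA ΩC ΩO f g) SameTotals := by
  have hZf : Moves (Zf Λ f) SellsShare := .sum fun q => (moves_ZOp q).smul _
  have hZdagf : Moves (Zdagf Λ f) (flip SellsShare) := .sum fun q => (moves_Zdag q).smul _
  have hog : Moves (og Λ g) LowersSupply := .sum fun q => (moves_oOp q).smul _
  have hodagg : Moves (odagg Λ g) (flip LowersSupply) := .sum fun q => (moves_odag q).smul _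
  have hfree : Moves (∑ q, (((ΩA q : ℝ) : ℂ) • Nhat Λ q + ((ΩC q : ℝ) : ℂ) • Khat Λ q
      + ((ΩO q : ℝ) : ℂ) • Ohat Λ q)) SameTotals :=
    .sum fun q => (((diagonalWith_Nhat q).moves_sameTotals.smul _).add
      ((diagonalWith_Khat q).moves_sameTotals.smul _)).add
      ((diagonalWith_Ohat q).moves_sameTotals.smul _)
  exact ((((diagonalWith_nhat.moves_sameTotals.smul _).add
    (diagonalWith_khat.moves_sameTotals.smul _)).add
    (diagonalWith_Phat.moves_sameTotals.smul _)).add hfree).add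
    (.smul _ ((((moves_zdag.mul hZf).mono sameTotals_of_sell_buy).add
      ((moves_zOp.mul hZdagf).mono sameTotals_of_buy_sell)).add
      (((moves_pdag.mul hog).mono sameTotals_of_lower_raise).add
      ((moves_pOp.mul hodagg).mono sameTotals_of_raise_lower))))

variable (Λ)

/-- the total number operator N̂ = n̂ + Σ_q N̂_q, the total cash
operator K̂ = k̂ + Σ_q K̂_q, and Γ̂ = P̂ + Σ_q Ô_q are constants of motion:
[H, N̂] = [H, K̂] = [H, Γ̂] = 0. -/
theorem reservoir_integrals_of_motion (ωa ωc ωp lam : ℝ) (ΩA ΩC ΩO : Λ → ℝ)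
    (f g : Λ → ℂ) :
    opComm Λ (HamR Λ ωa ωc ωp lam ΩA ΩC ΩO f g) (nhat Λ + ∑ q, Nhat Λ q) = 0 ∧
    opComm Λ (HamR Λ ωa ωc ωp lam ΩA ΩC ΩO f g) (khat Λ + ∑ q, Khat Λ q) = 0 ∧
    opComm Λ (HamR Λ ωa ωc ωp lam ΩA ΩC ΩO f g) (Phat Λ + ∑ q, Ohat Λ q) = 0 := by
  have hH := moves_HamR ωa ωc ωp lam ΩA ΩC ΩO f g
  exact ⟨(diagonalWith_nhat.add (.sum diagonalWith_Nhat)).opComm_eq_zero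
      (hH.mono fun _ _ h => h.1),
    (diagonalWith_khat.add (.sum diagonalWith_Khat)).opComm_eq_zero
      (hH.mono fun _ _ h => h.2.1),
    (diagonalWith_Phat.add (.sum diagonalWith_Ohat)).opComm_eq_zero
      (hH.mono fun _ _ h => h.2.2)⟩

end
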